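/- Let t ≥ 3 be an integer and let G be a (3t−1)/2-tough non-Hamiltonian graph on n ≥ 3 vertices possessing a Hamiltonian path v_1, v_2, …, v_n, with x = v_1 and y = v_n non-adjacent and d(x) + d(y) = n − t. Let S be the set of vertices adjacent to neither x nor y, and let S* = {v_i ∈ S : v_{i−1} y and v_{i+1} x are edges of G}. Then S* = ∅ and |S| ≤ 2t − 2. -/

import Mathlib

open SimpleGraph

/-- A graph `G` is `t`-tough if for every set `S` of vertices such that `G - S` is
disconnected, `t * c(G - S) ≤ |S|`, where `c` counts connected components. -/
def Tough {V : Type*} [Fintype V] (t : ℝ) (G : SimpleGraph V) : Prop :=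
  ∀ S : Finset V, ¬ (G.induce ((↑S : Set V)ᶜ)).Connected →
    t * (Nat.card (G.induce ((↑S : Set V)ᶜ)).ConnectedComponent) ≤ S.card

lemma ham_idx {V : Type*} [Fintype V] [DecidableEq V] {n : ℕ} (hn : 3 ≤ n)
    (G : SimpleGraph V) (v : ℕ → V)
    (hinj : ∀ i j, 1 ≤ i → i ≤ n → 1 ≤ j → j ≤ n → v i = v j → i = j)
    (hcard : Fintype.card V = n)
    (hpath : ∀ i, 1 ≤ i → i < n → G.Adj (v i) (v (i + 1)))
    (f : ℕ → ℕ) (hr : ∀ k, k < n → 1 ≤ f k ∧ f k ≤ n)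
    (hf : ∀ k l, k < n → l < n → f k = f l → k = l)
    (hadj : ∀ k, k + 1 < n → (f (k+1) = f k + 1 ∨ f k = f (k+1) + 1) ∨
      ∃ a b, f k = a ∧ f (k+1) = b ∧ G.Adj (v a) (v b))
    (hlast : ∃ a b, f (n-1) = a ∧ f 0 = b ∧ G.Adj (v a) (v b)) : G.IsHamiltonian := by
  have hadj' : ∀ k, k + 1 < n → G.Adj (v (f k)) (v (f (k+1))) := by
    intro k hk
    have h1 := hr k (by omega)
    have h2 := hr (k+1) (by omega)
    rcases hadj k hk with (h | h) | ⟨a, b, h, h', h''⟩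
    · rw [h]; exact hpath _ h1.1 (by omega)
    · rw [h]; exact (hpath _ h2.1 (by omega)).symm
    · rw [h, h']; exact h''
  have hl : G.Adj (v (f (n-1))) (v (f 0)) := by
    obtain ⟨a, b, h, h', h''⟩ := hlast
    rw [h, h']; exact h''
  have hsuc : ∀ a b : Fin n, (a - b).val = 1 → G.Adj (v (f b)) (v (f a)) := by
    intro a b hab
    rcases le_or_gt b a with h | h
    · rw [Fin.sub_val_of_le h] at hab
      have : a.val = b.val + 1 := by omega
      rw [this]
      exact hadj' _ (by omega)
    · rw [Fin.coe_sub_iff_lt.mpr h] at hab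
      have h1 : b.val = n - 1 := by omega
      have h2 : a.val = 0 := by omega
      rw [h1, h2]; exact hl
  have hc : (cycleGraph n).IsContained G := by
    refine ⟨⟨⟨fun k => v (f k), ?_⟩, ?_⟩⟩
    · intro a b hab
      rcases cycleGraph_adj'.mp hab with h | h
      · exact (hsuc _ _ h).symm
      · exact hsuc _ _ h
    · intro a b hab
      have h1 := hr a a.2
      have h2 := hr b b.2
      exact Fin.ext (hf _ _ a.2 b.2 (hinj _ _ h1.1 h1.2 h2.1 h2.2 hab))
  obtain ⟨a, p, hp, hpl⟩ := (cycleGraph_isContained_iff (by omega)).mp hc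
  exact fun _ => ⟨a, p, Walk.isHamiltonianCycle_iff_isCycle_and_length_eq.mpr ⟨hp, by omega⟩⟩

lemma tough_count {V : Type*} [Fintype V] [DecidableEq V] {c : ℝ} {G : SimpleGraph V}
    (hc : 0 ≤ c) (htough : Tough c G) (R J : Finset V) (x : V) (hx : x ∉ R) (hxJ : x ∉ J)
    (hJ : J.Nonempty) (hJR : ∀ w ∈ J, w ∉ R)
    (hN : ∀ w ∈ J, ∀ u, G.Adj w u → u ∈ R) : c * (J.card + 1) ≤ R.card := by
  set H := G.induce ((↑R : Set V)ᶜ) with hH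
  have key : ∀ a b : ((↑R : Set V)ᶜ : Set V), a.1 ∈ J → H.Reachable a b → a = b := by
    rintro a b ha ⟨p⟩
    cases p with
    | nil => rfl
    | @cons _ u _ h q => exact absurd (Finset.mem_coe.mpr (hN _ ha _ h)) u.2
  have hout : ∀ a ∈ insert x J, a ∈ ((↑R : Set V)ᶜ : Set V) := by
    intro a ha
    rcases Finset.mem_insert.mp ha with rfl | h
    · simpa using hx
    · simpa using hJR _ h
  let φ : {z // z ∈ insert x J} → H.ConnectedComponent :=
    fun z => H.connectedComponentMk ⟨z.1, hout _ z.2⟩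
  have hφ : Function.Injective φ := by
    rintro ⟨a, ha⟩ ⟨b, hb⟩ hab
    have hreach := ConnectedComponent.exact hab
    apply Subtype.ext
    show a = b
    rcases Finset.mem_insert.mp ha with h | h
    · rcases Finset.mem_insert.mp hb with h' | h'
      · rw [h, h']
      · exact (congrArg Subtype.val (key _ _ h' hreach.symm)).symm
    · exact congrArg Subtype.val (key _ _ h hreach)
  have hcard : J.card + 1 ≤ Nat.card H.ConnectedComponent := by
    have := Nat.card_le_card_of_injective φ hφ
    rw [Nat.card_eq_fintype_card, Fintype.card_coe, Finset.card_insert_of_notMem hxJ] at this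
    exact this
  have hdis : ¬ H.Connected := by
    intro h
    obtain ⟨w, hw⟩ := hJ
    have := key ⟨w, hout w (Finset.mem_insert_of_mem hw)⟩ ⟨x, hout x (Finset.mem_insert_self _ _)⟩
      hw (h.preconnected _ _)
    have h2 : w = x := congrArg Subtype.val this
    exact hxJ (h2 ▸ hw)
  refine le_trans ?_ (htough R hdis)
  apply mul_le_mul_of_nonneg_left _ hc
  exact_mod_cast hcard

/-- Let `t ≥ 3` be an integer and let `G` be a `(3t-1)/2`-tough non-Hamiltonian graph
on `n ≥ 3` vertices possessing a Hamiltonian path `v_1, v_2, …, v_n`, with `x = v_1`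
and `y = v_n` non-adjacent and `d(x) + d(y) = n - t`. Let `S` be the set of vertices
(other than `x` and `y`) adjacent to neither `x` nor `y`, and let
`S* = {v_i ∈ S : v_{i-1} y and v_{i+1} x are edges of G}`. Then `S* = ∅` and
`|S| ≤ 2t - 2`. -/
theorem stmt_16 {V : Type*} [Fintype V] [DecidableEq V] {n : ℕ} (hn : 3 ≤ n)
    (t : ℕ) (ht : 3 ≤ t)
    (G : SimpleGraph V) [DecidableRel G.Adj]
    (htough : Tough ((3 * t - 1 : ℝ) / 2) G) (hham : ¬ G.IsHamiltonian)
    (v : ℕ → V)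
    (hinj : ∀ i j, 1 ≤ i → i ≤ n → 1 ≤ j → j ≤ n → v i = v j → i = j)
    (hsurj : ∀ w : V, ∃ i, 1 ≤ i ∧ i ≤ n ∧ v i = w)
    (hpath : ∀ i, 1 ≤ i → i < n → G.Adj (v i) (v (i + 1)))
    (hnadj : ¬ G.Adj (v 1) (v n))
    (hdeg : G.degree (v 1) + G.degree (v n) = n - t)
    (S Sstar : Set V)
    (hS : S = {w | w ≠ v 1 ∧ w ≠ v n ∧ ¬ G.Adj w (v 1) ∧ ¬ G.Adj w (v n)})
    (hSstar : Sstar = {w | ∃ i, 1 ≤ i ∧ i ≤ n ∧ w = v i ∧ w ∈ S ∧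
      G.Adj (v (i - 1)) (v n) ∧ G.Adj (v (i + 1)) (v 1)}) :
    Sstar = ∅ ∧ S.ncard ≤ 2 * t - 2 := by
  classical
  have hinjOn : Set.InjOn v (↑(Finset.Icc 1 n) : Set ℕ) := by
    intro a ha b hb hab
    simp only [Finset.coe_Icc, Set.mem_Icc] at ha hb
    exact hinj _ _ ha.1 ha.2 hb.1 hb.2 hab
  have hcard : Fintype.card V = n := by
    have h : (Finset.Icc 1 n).image v = Finset.univ := by
      ext w
      obtain ⟨i, h1, h2, h3⟩ := hsurj w
      simp only [Finset.mem_image, Finset.mem_Icc, Finset.mem_univ, iff_true]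
      exact ⟨i, ⟨h1, h2⟩, h3⟩
    rw [← Finset.card_univ, ← h, Finset.card_image_of_injOn hinjOn]
    simp
  have ham := fun f hr hf hadj hlast =>
    hham (ham_idx hn G v hinj hcard hpath f hr hf hadj hlast)
  -- the six cycles
  have c1 : ∀ i, 1 ≤ i → i < n → G.Adj (v i) (v n) → G.Adj (v (i+1)) (v 1) → False := by
    intro i h1 h2 ha hb
    apply ham (fun k => if k < i then k + 1 else n + i - k)
    · intro k hk; split_ifs <;> omega
    · intro k l hk hl; split_ifs <;> omega
    · intro k hk
      by_cases e1 : k + 1 = i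
      · exact Or.inr ⟨i, n, by split_ifs <;> omega,
          by split_ifs <;> omega, ha⟩
      · left; split_ifs <;> omega
    · exact ⟨i+1, 1, by split_ifs <;> omega,
          by split_ifs <;> omega, hb⟩
  have c2 : ∀ i j, 1 ≤ i → i + 1 < j → j ≤ n → G.Adj (v i) (v j) → G.Adj (v (i+1)) (v 1) →
      G.Adj (v (j-1)) (v n) → False := by
    intro i j h1 h2 h3 ha hb hc
    apply ham (fun k => if k < j-1-i then i+1+k else if k < n - i then n+j-1-i-k else n-k)
    · intro k hk; split_ifs <;> omega
    · intro k l hk hl; split_ifs <;> omega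
    · intro k hk
      by_cases e1 : k + 1 = j-1-i
      · exact Or.inr ⟨j-1, n, by split_ifs <;> omega,
          by split_ifs <;> omega, hc⟩
      by_cases e2 : k + 1 = n - i
      · exact Or.inr ⟨j, i, by split_ifs <;> omega,
          by split_ifs <;> omega, ha.symm⟩
      · left; split_ifs <;> omega
    · exact ⟨1, i+1, by split_ifs <;> omega,
          by split_ifs <;> omega, hb.symm⟩
  have c3 : ∀ i j, 1 ≤ j → j + 1 < i → i < n → G.Adj (v i) (v j) → G.Adj (v (i+1)) (v 1) →
      G.Adj (v (j+1)) (v n) → False := by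
    intro i j h1 h2 h3 ha hb hc
    apply ham (fun k => if k < j then j - k else if k < j + n - i then i+1+k-j else k+i+1-n)
    · intro k hk; split_ifs <;> omega
    · intro k l hk hl; split_ifs <;> omega
    · intro k hk
      by_cases e1 : k + 1 = j
      · exact Or.inr ⟨1, i+1, by split_ifs <;> omega,
          by split_ifs <;> omega, hb.symm⟩
      by_cases e2 : k + 1 = j + n - i
      · exact Or.inr ⟨n, j+1, by split_ifs <;> omega,
          by split_ifs <;> omega, hc.symm⟩
      · left; split_ifs <;> omega
    · exact ⟨i, j, by split_ifs <;> omega,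
          by split_ifs <;> omega, ha⟩
  have c4 : ∀ i j, 1 ≤ j → j + 1 < i → i < n → G.Adj (v i) (v j) → G.Adj (v (i-1)) (v n) →
      G.Adj (v (j+1)) (v 1) → False := by
    intro i j h1 h2 h3 ha hb hc
    apply ham (fun k => if k < j then j - k else if k < i-1 then k+1 else n+i-1-k)
    · intro k hk; split_ifs <;> omega
    · intro k l hk hl; split_ifs <;> omega
    · intro k hk
      by_cases e1 : k + 1 = j
      · exact Or.inr ⟨1, j+1, by split_ifs <;> omega,
          by split_ifs <;> omega, hc.symm⟩
      by_cases e2 : k + 1 = i - 1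
      · exact Or.inr ⟨i-1, n, by split_ifs <;> omega,
          by split_ifs <;> omega, hb⟩
      · left; split_ifs <;> omega
    · exact ⟨i, j, by split_ifs <;> omega,
          by split_ifs <;> omega, ha⟩
  have c5 : ∀ i j, 1 < i → i + 1 < j → j ≤ n → G.Adj (v i) (v j) → G.Adj (v (i-1)) (v n) →
      G.Adj (v (j-1)) (v 1) → False := by
    intro i j h1 h2 h3 ha hb hc
    apply ham (fun k => if k < n-j+1 then j+k else if k < n-j+i then n-j+i-k else n+i-1-k)
    · intro k hk; split_ifs <;> omega
    · intro k l hk hl; split_ifs <;> omega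
    · intro k hk
      by_cases e1 : k + 1 = n-j+1
      · exact Or.inr ⟨n, i-1, by split_ifs <;> omega,
          by split_ifs <;> omega, hb.symm⟩
      by_cases e2 : k + 1 = n-j+i
      · exact Or.inr ⟨1, j-1, by split_ifs <;> omega,
          by split_ifs <;> omega, hc.symm⟩
      · left; split_ifs <;> omega
    · exact ⟨i, j, by split_ifs <;> omega,
          by split_ifs <;> omega, ha⟩
  have c6 : ∀ i j, 1 < i → i + 1 < j → j ≤ n → G.Adj (v i) (v j) → G.Adj (v (i+1)) (v 1) →
      G.Adj (v (j-1)) (v n) → False := by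
    intro i j h1 h2 h3 ha hb hc
    exact c2 i j (by omega) h2 h3 ha hb hc
  -- index descriptions
  have memS : ∀ i, 1 ≤ i → i ≤ n → (v i ∈ S ↔ 1 < i ∧ i < n ∧ ¬ G.Adj (v i) (v 1) ∧
      ¬ G.Adj (v i) (v n)) := by
    intro i h1 h2
    rw [hS]
    simp only [Set.mem_ofPred_eq]
    constructor
    · rintro ⟨a, b, c, d⟩
      refine ⟨?_, ?_, c, d⟩
      · rcases Nat.lt_or_ge 1 i with h | h
        · exact h
        · exact absurd (congrArg v (by omega)) a
      · rcases Nat.lt_or_ge i n with h | h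
        · exact h
        · exact absurd (congrArg v (by omega)) b
    · rintro ⟨a, b, c, d⟩
      refine ⟨fun h => ?_, fun h => ?_, c, d⟩
      · have := hinj _ _ h1 h2 (by omega) (by omega) h; omega
      · have := hinj _ _ h1 h2 (by omega) (by omega) h; omega
  set P : Finset ℕ := (Finset.Icc 1 n).filter (fun i => v i ∈ S) with hP
  set Q : Finset ℕ := P.filter (fun i => G.Adj (v (i-1)) (v n) ∧ G.Adj (v (i+1)) (v 1)) with hQ
  have memP : ∀ i, i ∈ P ↔ 1 < i ∧ i < n ∧ ¬ G.Adj (v i) (v 1) ∧ ¬ G.Adj (v i) (v n) := by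
    intro i
    rw [hP, Finset.mem_filter, Finset.mem_Icc]
    constructor
    · rintro ⟨⟨a, b⟩, c⟩; exact (memS i a b).mp c
    · intro h; exact ⟨⟨by omega, by omega⟩, (memS i (by omega) (by omega)).mpr h⟩
  have memQ : ∀ i, i ∈ Q ↔ i ∈ P ∧ G.Adj (v (i-1)) (v n) ∧ G.Adj (v (i+1)) (v 1) := by
    intro i; rw [hQ, Finset.mem_filter]
  have hncard : S.ncard = P.card := by
    have : S = ↑(P.image v) := by
      ext w
      simp only [Finset.coe_image, Set.mem_image, Finset.mem_coe, hP, Finset.mem_filter,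
        Finset.mem_Icc]
      constructor
      · intro hw
        obtain ⟨i, h1, h2, rfl⟩ := hsurj w
        exact ⟨i, ⟨⟨h1, h2⟩, hw⟩, rfl⟩
      · rintro ⟨i, ⟨_, h⟩, rfl⟩; exact h
    rw [this, Set.ncard_coe_finset, Finset.card_image_of_injOn]
    exact hinjOn.mono (by exact_mod_cast Finset.filter_subset _ _)
  -- counting
  set A := (Finset.Icc 1 (n-1)).filter (fun i => G.Adj (v i) (v n)) with hA
  set B := (Finset.Icc 1 (n-1)).filter (fun i => G.Adj (v (i+1)) (v 1)) with hB
  set T := (Finset.Icc 1 (n-1)).filter (fun i => ¬ G.Adj (v i) (v n) ∧ ¬ G.Adj (v (i+1)) (v 1))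
    with hT
  have hAc : G.degree (v n) ≤ A.card := by
    rw [← card_neighborFinset_eq_degree]
    refine le_trans (Finset.card_le_card ?_) (Finset.card_image_le (f := v))
    intro w hw
    rw [mem_neighborFinset] at hw
    obtain ⟨i, h1, h2, rfl⟩ := hsurj w
    have : i ≠ n := by rintro rfl; exact G.loopless.irrefl _ hw
    exact Finset.mem_image.mpr ⟨i, Finset.mem_filter.mpr
      ⟨Finset.mem_Icc.mpr ⟨h1, by omega⟩, hw.symm⟩, rfl⟩
  have hBc : G.degree (v 1) ≤ B.card := by
    rw [← card_neighborFinset_eq_degree]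
    refine le_trans (Finset.card_le_card ?_) (Finset.card_image_le (f := fun i => v (i+1)))
    intro w hw
    rw [mem_neighborFinset] at hw
    obtain ⟨i, h1, h2, rfl⟩ := hsurj w
    have : i ≠ 1 := by rintro rfl; exact G.loopless.irrefl _ hw
    have e : i - 1 + 1 = i := by omega
    exact Finset.mem_image.mpr ⟨i-1, Finset.mem_filter.mpr
      ⟨Finset.mem_Icc.mpr ⟨by omega, by omega⟩, by rw [e]; exact hw.symm⟩, by
        rw [e]⟩
  have hABT : A.card + B.card + T.card ≤ n - 1 := by
    have d1 : Disjoint A B := by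
      rw [Finset.disjoint_left]
      intro i hi hi'
      rw [hA, Finset.mem_filter, Finset.mem_Icc] at hi
      rw [hB, Finset.mem_filter] at hi'
      exact c1 i hi.1.1 (by omega) hi.2 hi'.2
    have d2 : Disjoint (A ∪ B) T := by
      rw [Finset.disjoint_left]
      intro i hi hi'
      rw [hT, Finset.mem_filter] at hi'
      rcases Finset.mem_union.mp hi with h | h
      · exact hi'.2.1 (Finset.mem_filter.mp h).2
      · exact hi'.2.2 (Finset.mem_filter.mp h).2
    rw [← Finset.card_union_of_disjoint d1, ← Finset.card_union_of_disjoint d2]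
    refine le_trans (Finset.card_le_card (t := Finset.Icc 1 (n-1)) ?_) (by simp)
    intro i hi
    rcases Finset.mem_union.mp hi with h | h
    · rcases Finset.mem_union.mp h with h | h
      · exact (Finset.mem_filter.mp h).1
      · exact (Finset.mem_filter.mp h).1
    · exact (Finset.mem_filter.mp h).1
  have hdx : 1 ≤ G.degree (v 1) := by
    rw [Nat.one_le_iff_ne_zero, ← Nat.pos_iff_ne_zero, degree_pos_iff_exists_adj]
    exact ⟨_, hpath 1 le_rfl (by omega)⟩
  have hTc : T.card ≤ t - 1 := by omega
  have hPQ : P.card ≤ 2 * t - 2 + Q.card := by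
    have hsub : P ⊆ (T ∪ T.image (· + 1)) ∪ Q := by
      intro i hi
      have hi' := (memP i).mp hi
      by_cases h1 : G.Adj (v (i-1)) (v n)
      · by_cases h2 : G.Adj (v (i+1)) (v 1)
        · exact Finset.mem_union_right _ ((memQ i).mpr ⟨hi, h1, h2⟩)
        · refine Finset.mem_union_left _ (Finset.mem_union_left _ ?_)
          exact Finset.mem_filter.mpr ⟨Finset.mem_Icc.mpr ⟨by omega, by omega⟩, hi'.2.2.2, h2⟩
      · refine Finset.mem_union_left _ (Finset.mem_union_right _ ?_)
        have e : i - 1 + 1 = i := by omega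
        refine Finset.mem_image.mpr ⟨i-1, Finset.mem_filter.mpr
          ⟨Finset.mem_Icc.mpr ⟨by omega, by omega⟩, h1, ?_⟩, e⟩
        rw [e]; exact hi'.2.2.1
    have h1 := Finset.card_le_card hsub
    have h2 := Finset.card_union_le (T ∪ T.image (· + 1)) Q
    have h3 := Finset.card_union_le T (T.image (· + 1))
    have h4 := Finset.card_image_le (s := T) (f := (· + 1))
    omega
  -- neighbours of a star vertex
  have nlt : ∀ i ∈ Q, ∀ j, 1 ≤ j → j + 1 < i → G.Adj (v i) (v j) → j + 1 ∈ P := by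
    intro i hi j h1 h2 ha
    obtain ⟨hp, hb, hc⟩ := (memQ i).mp hi
    have hp' := (memP i).mp hp
    refine (memP _).mpr ⟨by omega, by omega, fun h => ?_, fun h => ?_⟩
    · exact c4 i j h1 h2 hp'.2.1 ha hb h
    · exact c3 i j h1 h2 hp'.2.1 ha hc h
  have ngt : ∀ i ∈ Q, ∀ j, j ≤ n → i + 1 < j → G.Adj (v i) (v j) → j - 1 ∈ P := by
    intro i hi j h1 h2 ha
    obtain ⟨hp, hb, hc⟩ := (memQ i).mp hi
    have hp' := (memP i).mp hp
    refine (memP _).mpr ⟨by omega, by omega, fun h => ?_, fun h => ?_⟩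
    · exact c5 i j hp'.1 h2 h1 ha hb h
    · exact c6 i j hp'.1 h2 h1 ha hc h
  have hQe : Q = ∅ := by
    by_contra hne
    obtain ⟨w, hw⟩ := Finset.nonempty_iff_ne_empty.mpr hne
    have hc0 : (0:ℝ) ≤ (3 * t - 1 : ℝ) / 2 := by
      have : (3:ℝ) ≤ t := by exact_mod_cast ht
      linarith
    have hwP := ((memQ w).mp hw).1
    have hw' := (memP w).mp hwP
    -- degree
    have hd : 3 * t - 1 ≤ G.degree (v w) := by
      have := tough_count hc0 htough (G.neighborFinset (v w)) {v w} (v 1)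
        (by rw [mem_neighborFinset]; exact hw'.2.2.1)
        (by rw [Finset.mem_singleton]; intro h
            have := hinj _ _ (by omega) (by omega) (by omega) (by omega) h; omega)
        (Finset.singleton_nonempty _)
        (by intro u hu; rw [Finset.mem_singleton] at hu; subst hu; simp)
        (by intro u hu z hz; rw [Finset.mem_singleton] at hu; subst hu
            rwa [mem_neighborFinset])
      rw [card_neighborFinset_eq_degree] at this
      have h2 : ((3 * t : ℕ) : ℝ) ≤ ((G.degree (v w) + 1 : ℕ) : ℝ) := by
        push_cast
        simp only [Finset.card_singleton, Nat.cast_one] at this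
        linarith
      have h3 : 3 * t ≤ G.degree (v w) + 1 := by exact_mod_cast h2
      omega
    have hd2 : G.degree (v w) ≤ P.card + 1 := by
      let g : ℕ → V := fun k => if k < w then v (k - 1) else v (k + 1)
      have hsub : G.neighborFinset (v w) ⊆
          insert (v (w-1)) (insert (v (w+1)) ((P.erase w).image g)) := by
        intro u hu
        rw [mem_neighborFinset] at hu
        obtain ⟨j, h1, h2, rfl⟩ := hsurj u
        simp only [Finset.mem_insert, Finset.mem_image, Finset.mem_erase]
        rcases lt_trichotomy j w with h | h | h
        · by_cases e : j = w - 1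
          · left; rw [e]
          · right; right
            refine ⟨j+1, ⟨by omega, nlt w hw j h1 (by omega) hu⟩, ?_⟩
            simp only [g]
            rw [if_pos (by omega)]; rfl
        · subst h; exact absurd hu (G.loopless.irrefl _)
        · by_cases e : j = w + 1
          · right; left; rw [e]
          · right; right
            refine ⟨j-1, ⟨by omega, ngt w hw j h2 (by omega) hu⟩, ?_⟩
            simp only [g]
            rw [if_neg (by omega)]; congr 1; omega
      have h1 := Finset.card_le_card hsub
      rw [card_neighborFinset_eq_degree] at h1
      have h2 := Finset.card_insert_le (v (w-1)) (insert (v (w+1)) ((P.erase w).image g))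
      have h3 := Finset.card_insert_le (v (w+1)) ((P.erase w).image g)
      have h4 := Finset.card_image_le (s := P.erase w) (f := g)
      have h5 := Finset.card_erase_add_one hwP
      omega
    have hindep : ∀ i ∈ Q, ∀ j ∈ Q, i < j → ¬ G.Adj (v i) (v j) := by
      intro i hi j hj hij ha
      obtain ⟨hp, hb, hc⟩ := (memQ i).mp hi
      obtain ⟨hp2, hb2, hc2⟩ := (memQ j).mp hj
      have hi' := (memP i).mp hp
      have hj' := (memP j).mp hp2
      by_cases e : j = i + 1
      · subst e; exact hj'.2.2.1 hc
      · exact c2 i j (by omega) (by omega) (by omega) ha hc hb2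
    set R : Finset V := Finset.univ.filter (fun u => ∃ i ∈ Q, G.Adj (v i) u) with hR
    have hRc : R.card ≤ 2 * P.card := by
      have hsub : R ⊆ P.image (fun k => v (k-1)) ∪ P.image (fun k => v (k+1)) := by
        intro u hu
        obtain ⟨i, hi, ha⟩ := (Finset.mem_filter.mp hu).2
        have hiP := ((memQ i).mp hi).1
        obtain ⟨j, h1, h2, rfl⟩ := hsurj u
        rcases lt_trichotomy j i with h | h | h
        · refine Finset.mem_union_left _ (Finset.mem_image.mpr ⟨j+1, ?_, rfl⟩)
          by_cases e : j + 1 = i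
          · rw [e]; exact hiP
          · exact nlt i hi j h1 (by omega) ha
        · subst h; exact absurd ha (G.loopless.irrefl _)
        · refine Finset.mem_union_right _ (Finset.mem_image.mpr ⟨j-1, ?_, by
            congr 1; omega⟩)
          by_cases e : j = i + 1
          · rw [e]; exact hiP
          · exact ngt i hi j h2 (by omega) ha
      have h1 := Finset.card_le_card hsub
      have h2 := Finset.card_union_le (P.image (fun k => v (k-1))) (P.image (fun k => v (k+1)))
      have h3 := Finset.card_image_le (s := P) (f := fun k => v (k-1))
      have h4 := Finset.card_image_le (s := P) (f := fun k => v (k+1))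
      omega
    have hQim : (Q.image v).card = Q.card := by
      apply Finset.card_image_of_injOn
      apply hinjOn.mono
      intro i hi
      have := (memP i).mp ((memQ i).mp hi).1
      simp only [Finset.coe_Icc, Set.mem_Icc]
      omega
    have key := tough_count hc0 htough R (Q.image v) (v 1)
      (by
        intro h
        obtain ⟨i, hi, ha⟩ := (Finset.mem_filter.mp h).2
        exact ((memP i).mp ((memQ i).mp hi).1).2.2.1 ha)
      (by
        intro h
        obtain ⟨i, hi, ha⟩ := Finset.mem_image.mp h
        have hi' := (memP i).mp ((memQ i).mp hi).1
        have := hinj _ _ (by omega) (by omega) (by omega) (by omega) ha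
        omega)
      (Finset.Nonempty.image ⟨w, hw⟩ v)
      (by
        intro u hu h
        obtain ⟨j, hj, rfl⟩ := Finset.mem_image.mp hu
        obtain ⟨i, hi, ha⟩ := (Finset.mem_filter.mp h).2
        rcases lt_trichotomy i j with h | h | h
        · exact hindep i hi j hj h ha
        · subst h; exact G.loopless.irrefl _ ha
        · exact hindep j hj i hi h ha.symm)
      (by
        intro u hu z hz
        obtain ⟨j, hj, rfl⟩ := Finset.mem_image.mp hu
        exact Finset.mem_filter.mpr ⟨Finset.mem_univ _, j, hj, hz⟩)
    rw [hQim] at key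
    have hs : t ≤ Q.card := by omega
    have hRQ : R.card + 4 ≤ 4 * t + 2 * Q.card := by omega
    have hRQ' : (R.card : ℝ) + 4 ≤ 4 * t + 2 * Q.card := by exact_mod_cast hRQ
    have hs' : (t : ℝ) ≤ Q.card := by exact_mod_cast hs
    have ht' : (3 : ℝ) ≤ t := by exact_mod_cast ht
    nlinarith [mul_nonneg (sub_nonneg.mpr ht') (sub_nonneg.mpr hs'),
      mul_nonneg (sub_nonneg.mpr ht') (sub_nonneg.mpr ht')]
  constructor
  · rw [hSstar, Set.eq_empty_iff_forall_notMem]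
    rintro u ⟨i, h1, h2, rfl, h3, h4, h5⟩
    have : i ∈ Q := (memQ i).mpr ⟨(memP i).mpr ((memS i h1 h2).mp h3), h4, h5⟩
    rw [hQe] at this
    simp at this
  · rw [hncard]
    rw [hQe, Finset.card_empty] at hPQ
    exact hPQ
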